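/- arXiv:2112.13720 — 5 statements merged into one kernel-verified Lean document; each statement's English description precedes it below -/
import Mathlib

section
/- Let G be a nonzero n×n real symmetric positive semi-definite matrix, let α ≥ 2 be an integer, let ε, δ ∈ (0,1), and set s = ⌈8·ln(2/δ)/ε²⌉. Let g₁,…,g_s be i.i.d. standard Gaussian vectors in ℝⁿ and define the estimator S̃_α(G) = (1/(1−α))·log₂((1/s)·Σ_{i=1}^s gᵢᵀ Gᵅ gᵢ). Then with probability at least 1−δ one has |S_α(G) − S̃_α(G)| ≤ |(1/(1−α))·log₂(1−ε)|. -/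
open MeasureTheory ProbabilityTheory Matrix

/-- Joint law of `s` i.i.d. standard Gaussian vectors in `ℝⁿ`
(each vector has `n` i.i.d. standard normal coordinates). -/
noncomputable def gaussianVecs (s n : ℕ) : Measure (Fin s → Fin n → ℝ) :=
  Measure.pi fun _ => Measure.pi fun _ => gaussianReal 0 1

lemma Matrix.IsHermitian.eq_zero_of_pow_eq_zero {ι : Type*} [Fintype ι] [DecidableEq ι]
    {A : Matrix ι ι ℝ} (hA : A.IsHermitian) {k : ℕ} (h : A ^ k = 0) : A = 0 := by
  rw [← hA.eigenvalues_eq_zero_iff]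
  ext j
  have hpow : ∀ m : ℕ, (A ^ m) *ᵥ (hA.eigenvectorBasis j).ofLp
      = hA.eigenvalues j ^ m • (hA.eigenvectorBasis j).ofLp := by
    intro m
    induction m with
    | zero => simp
    | succ m ih =>
      rw [pow_succ, ← mulVec_mulVec, hA.mulVec_eigenvectorBasis, mulVec_smul, ih, smul_smul,
        pow_succ']
  have hne : (hA.eigenvectorBasis j).ofLp ≠ 0 := fun h0 =>
    hA.eigenvectorBasis.orthonormal.ne_zero j (by simpa using h0)
  have hk := hpow k
  rw [h, zero_mulVec] at hk
  exact _root_.eq_zero_of_pow_eq_zero ((smul_eq_zero.1 hk.symm).resolve_right hne)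

/-- The quadratic form of a real symmetric matrix is the sum of the squared coordinates in an
eigenbasis, weighted by the eigenvalues. -/
lemma Matrix.IsHermitian.dotProduct_mulVec_eq_sum_eigenvalues {ι : Type*} [Fintype ι]
    [DecidableEq ι] {A : Matrix ι ι ℝ} (hA : A.IsHermitian) (x : ι → ℝ) :
    x ⬝ᵥ A *ᵥ x = ∑ j, hA.eigenvalues j * ((hA.eigenvectorBasis j).ofLp ⬝ᵥ x) ^ 2 := by
  have h := hA.eigenvectorBasis.sum_inner_mul_inner (WithLp.toLp 2 x) (WithLp.toLp 2 (A *ᵥ x))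
  simp only [EuclideanSpace.inner_eq_star_dotProduct, star_trivial] at h
  rw [dotProduct_comm, ← h]
  refine Finset.sum_congr rfl fun j _ => ?_
  have hj : (A *ᵥ x) ⬝ᵥ (hA.eigenvectorBasis j).ofLp
      = hA.eigenvalues j * ((hA.eigenvectorBasis j).ofLp ⬝ᵥ x) := by
    have hT : Aᵀ = A := by simpa using hA.eq
    rw [dotProduct_comm, dotProduct_mulVec, ← mulVec_transpose, hT, hA.mulVec_eigenvectorBasis,
      smul_dotProduct, smul_eq_mul]
  rw [hj]
  ring

/-- The projection of a standard Gaussian vector on a unit vector is a standard normal variable. -/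
lemma measurePreserving_dotProduct_pi_gaussianReal {ι : Type*} [Fintype ι]
    (u : EuclideanSpace ℝ ι) (hu : ‖u‖ = 1) :
    MeasurePreserving (fun x : ι → ℝ => u.ofLp ⬝ᵥ x) (Measure.pi fun _ => gaussianReal 0 1)
      (gaussianReal 0 1) := by
  refine ⟨by unfold dotProduct; fun_prop, ?_⟩
  have hcomp : (fun x : ι → ℝ => u.ofLp ⬝ᵥ x) = innerSL ℝ u ∘ WithLp.toLp 2 := by
    ext x
    simp [EuclideanSpace.inner_eq_star_dotProduct, dotProduct_comm]
  rw [hcomp, ← Measure.map_map (by fun_prop) (by fun_prop), map_pi_eq_stdGaussian]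
  apply Measure.ext_of_charFun
  ext t
  rw [charFun_map_eq_charFunDual_smul, charFunDual_stdGaussian, charFun_gaussianReal]
  simp [norm_smul, hu, neg_div, ← Complex.ofReal_pow]

lemma gaussianPDFReal_mul_exp_mul_sq (θ x : ℝ) :
    gaussianPDFReal 0 1 x * Real.exp (θ * x ^ 2)
      = (√(2 * Real.pi))⁻¹ * Real.exp (-(1 / 2 - θ) * x ^ 2) := by
  simp only [gaussianPDFReal, NNReal.coe_one, mul_one, sub_zero]
  rw [mul_assoc, ← Real.exp_add]
  ring_nf

lemma integrable_exp_mul_sq_gaussianReal {θ : ℝ} (hθ : θ < 1 / 2) :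
    Integrable (fun x => Real.exp (θ * x ^ 2)) (gaussianReal 0 1) := by
  rw [gaussianReal_of_var_ne_zero _ one_ne_zero,
    integrable_withDensity_iff_integrable_smul' (measurable_gaussianPDF _ _)
      (ae_of_all _ fun _ => gaussianPDF_lt_top)]
  refine ((integrable_exp_neg_mul_sq (b := 1 / 2 - θ) (by linarith)).const_mul
    (√(2 * Real.pi))⁻¹).congr (ae_of_all _ fun x => ?_)
  simp only [toReal_gaussianPDF, smul_eq_mul, gaussianPDFReal_mul_exp_mul_sq]

/-- The moment generating function of the square of a standard normal variable. -/
lemma integral_exp_mul_sq_gaussianReal {θ : ℝ} (hθ : θ < 1 / 2) :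
    ∫ x, Real.exp (θ * x ^ 2) ∂gaussianReal 0 1 = (√(1 - 2 * θ))⁻¹ := by
  rw [integral_gaussianReal_eq_integral_smul one_ne_zero]
  simp_rw [smul_eq_mul, gaussianPDFReal_mul_exp_mul_sq]
  rw [integral_const_mul, integral_gaussian, ← Real.sqrt_inv, ← Real.sqrt_inv, ← Real.sqrt_mul
    (by positivity)]
  congr 1
  have h1 : (1 / 2 - θ) ≠ 0 := by linarith
  have h2 : (1 - 2 * θ) ≠ 0 := by linarith
  have := Real.pi_ne_zero
  field_simp

/-- The quadratic form of a positive semidefinite matrix, normalized by the trace, has under the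
standard Gaussian law a moment generating function dominated by that of `χ²₁`. -/
lemma Matrix.PosSemidef.mgf_quadraticForm_le {ι : Type*} [Fintype ι] {A : Matrix ι ι ℝ}
    (hA : A.PosSemidef) (hA0 : A ≠ 0) {θ : ℝ} (hθ : θ < 1 / 2) :
    Integrable (fun x : ι → ℝ => Real.exp (θ * ((x ⬝ᵥ A *ᵥ x) / A.trace)))
        (Measure.pi fun _ => gaussianReal 0 1) ∧
      ∫ x : ι → ℝ, Real.exp (θ * ((x ⬝ᵥ A *ᵥ x) / A.trace))
        ∂(Measure.pi fun _ => gaussianReal 0 1) ≤ (√(1 - 2 * θ))⁻¹ := by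
  classical
  set lam := hA.1.eigenvalues
  set u := hA.1.eigenvectorBasis
  have htr : A.trace = ∑ j, lam j := by simpa using hA.1.trace_eq_sum_eigenvalues
  have htr0 : A.trace ≠ 0 := hA.trace_eq_zero_iff.not.2 hA0
  have htr1 : 0 < A.trace := lt_of_le_of_ne hA.trace_nonneg htr0.symm
  have hp0 : ∀ j ∈ Finset.univ, 0 ≤ lam j / A.trace := fun j _ =>
    div_nonneg (hA.eigenvalues_nonneg j) htr1.le
  have hp1 : ∑ j, lam j / A.trace = 1 := by
    rw [← Finset.sum_div, ← htr, div_self htr0]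
  have hmp : ∀ j, MeasurePreserving (fun x : ι → ℝ => (u j).ofLp ⬝ᵥ x)
      (Measure.pi fun _ => gaussianReal 0 1) (gaussianReal 0 1) := fun j =>
    measurePreserving_dotProduct_pi_gaussianReal (u j) (u.orthonormal.1 j)
  have hle : ∀ x : ι → ℝ, Real.exp (θ * ((x ⬝ᵥ A *ᵥ x) / A.trace))
      ≤ ∑ j, lam j / A.trace * Real.exp (θ * ((u j).ofLp ⬝ᵥ x) ^ 2) := by
    intro x
    have h := convexOn_exp.map_sum_le (p := fun j => θ * ((u j).ofLp ⬝ᵥ x) ^ 2) hp0 hp1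
      (fun _ _ => Set.mem_univ _)
    simp only [smul_eq_mul] at h
    refine le_trans (le_of_eq ?_) h
    rw [hA.1.dotProduct_mulVec_eq_sum_eigenvalues, Finset.sum_div, Finset.mul_sum]
    congr 1
    exact Finset.sum_congr rfl fun j _ => by ring
  have hint : ∀ j ∈ Finset.univ, Integrable
      (fun x : ι → ℝ => lam j / A.trace * Real.exp (θ * ((u j).ofLp ⬝ᵥ x) ^ 2))
      (Measure.pi fun _ => gaussianReal 0 1) := fun j _ =>
    ((hmp j).integrable_comp_of_integrable (integrable_exp_mul_sq_gaussianReal hθ)).const_mul _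
  have hexp : Integrable (fun x : ι → ℝ => Real.exp (θ * ((x ⬝ᵥ A *ᵥ x) / A.trace)))
      (Measure.pi fun _ => gaussianReal 0 1) := by
    refine (integrable_finsetSum _ hint).mono' ?_ (ae_of_all _ fun x => ?_)
    · refine Measurable.aestronglyMeasurable ?_
      unfold mulVec dotProduct
      fun_prop
    · rw [Real.norm_of_nonneg (Real.exp_pos _).le]
      exact hle x
  refine ⟨hexp, (integral_mono hexp (integrable_finsetSum _ hint) hle).trans (le_of_eq ?_)⟩
  have hj : ∀ j, ∫ x : ι → ℝ, Real.exp (θ * ((u j).ofLp ⬝ᵥ x) ^ 2)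
      ∂(Measure.pi fun _ => gaussianReal 0 1) = (√(1 - 2 * θ))⁻¹ := by
    intro j
    rw [← integral_exp_mul_sq_gaussianReal hθ]
    conv_rhs => rw [← (hmp j).map_eq]
    rw [integral_map (hmp j).measurable.aemeasurable
      (Measurable.aestronglyMeasurable (by fun_prop))]
  rw [integral_finsetSum _ hint]
  simp_rw [integral_const_mul, hj]
  rw [← Finset.sum_mul, hp1, one_mul]

instance isProbabilityMeasure_gaussianVecs (s n : ℕ) : IsProbabilityMeasure (gaussianVecs s n) := by
  unfold gaussianVecs
  infer_instance

lemma Matrix.PosSemidef.mgf_sum_quadraticForm_le {n : ℕ} {A : Matrix (Fin n) (Fin n) ℝ}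
    (hA : A.PosSemidef) (hA0 : A ≠ 0) (s : ℕ) {θ : ℝ} (hθ : θ < 1 / 2) :
    Integrable (fun g : Fin s → Fin n → ℝ =>
        Real.exp (θ * ∑ i, (g i ⬝ᵥ A *ᵥ g i) / A.trace)) (gaussianVecs s n) ∧
      mgf (fun g : Fin s → Fin n → ℝ => ∑ i, (g i ⬝ᵥ A *ᵥ g i) / A.trace) (gaussianVecs s n) θ
        ≤ (√(1 - 2 * θ))⁻¹ ^ s := by
  obtain ⟨h1, h2⟩ := hA.mgf_quadraticForm_le hA0 hθ
  unfold mgf gaussianVecs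
  simp_rw [Finset.mul_sum, Real.exp_sum]
  refine ⟨Integrable.fintype_prod fun _ => h1, ?_⟩
  rw [integral_fintype_prod_eq_pow (ι := Fin s)
    (fun x : Fin n → ℝ => Real.exp (θ * ((x ⬝ᵥ A *ᵥ x) / A.trace))), Fintype.card_fin]
  exact pow_le_pow_left₀ (integral_nonneg fun _ => (Real.exp_pos _).le) h2 s

lemma exp_mul_inv_sqrt_pow {r : ℝ} (hr : 0 < r) (s : ℕ) :
    Real.exp (-((1 - r⁻¹) / 2) * (s * r)) * (√(1 - 2 * ((1 - r⁻¹) / 2)))⁻¹ ^ s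
      = Real.exp (-(s / 2 * (r - 1 - Real.log r))) := by
  have h : (√(1 - 2 * ((1 - r⁻¹) / 2)))⁻¹ = Real.exp (Real.log r / 2) := by
    rw [show 1 - 2 * ((1 - r⁻¹) / 2) = r⁻¹ by ring, Real.sqrt_inv, inv_inv, Real.exp_half,
      Real.exp_log hr]
  rw [h, ← Real.exp_nat_mul, ← Real.exp_add]
  congr 1
  field_simp
  ring

/-- Chernoff bound for the upper tail. -/
lemma Matrix.PosSemidef.measureReal_le_sum_quadraticForm_le {n : ℕ}
    {A : Matrix (Fin n) (Fin n) ℝ} (hA : A.PosSemidef) (hA0 : A ≠ 0) (s : ℕ) {r : ℝ}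
    (hr : 1 ≤ r) :
    (gaussianVecs s n).real {g | s * r ≤ ∑ i, (g i ⬝ᵥ A *ᵥ g i) / A.trace}
      ≤ Real.exp (-(s / 2 * (r - 1 - Real.log r))) := by
  have hr0 : 0 < r := by linarith
  have hinv : 0 < r⁻¹ := inv_pos.2 hr0
  have hinv1 : r⁻¹ ≤ 1 := inv_le_one_of_one_le₀ hr
  obtain ⟨h1, h2⟩ := hA.mgf_sum_quadraticForm_le hA0 s (θ := (1 - r⁻¹) / 2) (by linarith)
  rw [← exp_mul_inv_sqrt_pow hr0]
  exact (measure_ge_le_exp_mul_mgf _ (by linarith) h1).trans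
    (mul_le_mul_of_nonneg_left h2 (Real.exp_pos _).le)

/-- Chernoff bound for the lower tail. -/
lemma Matrix.PosSemidef.measureReal_sum_quadraticForm_le_le {n : ℕ}
    {A : Matrix (Fin n) (Fin n) ℝ} (hA : A.PosSemidef) (hA0 : A ≠ 0) (s : ℕ) {r : ℝ}
    (hr0 : 0 < r) (hr : r ≤ 1) :
    (gaussianVecs s n).real {g | ∑ i, (g i ⬝ᵥ A *ᵥ g i) / A.trace ≤ s * r}
      ≤ Real.exp (-(s / 2 * (r - 1 - Real.log r))) := by
  have hinv : 0 < r⁻¹ := inv_pos.2 hr0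
  have hinv1 : 1 ≤ r⁻¹ := (one_le_inv₀ hr0).2 hr
  obtain ⟨h1, h2⟩ := hA.mgf_sum_quadraticForm_le hA0 s (θ := (1 - r⁻¹) / 2) (by linarith)
  rw [← exp_mul_inv_sqrt_pow hr0]
  exact (measure_le_le_exp_mul_mgf _ (by linarith) h1).trans
    (mul_le_mul_of_nonneg_left h2 (Real.exp_pos _).le)

lemma sq_div_four_le_sub_one_sub_log {ε : ℝ} (h0 : 0 < ε) (h1 : ε < 1) :
    ε ^ 2 / 4 ≤ (1 - ε) - 1 - Real.log (1 - ε) := by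
  obtain ⟨w, hw, hw2⟩ : ∃ w, 0 < w ∧ w ^ 2 = 1 - ε :=
    ⟨√(1 - ε), Real.sqrt_pos.2 (by linarith), Real.sq_sqrt (by linarith)⟩
  have hw1 : w < 1 := by nlinarith
  have hlog := Real.log_le_sub_one_of_pos hw
  rw [← hw2, Real.log_pow, show ε = 1 - w ^ 2 by linarith]
  push_cast
  nlinarith [mul_nonneg (sq_nonneg (1 - w)) (show 0 ≤ (1 - w) * (3 + w) by nlinarith)]

lemma sq_div_four_le_inv_sub_one_sub_log {ε : ℝ} (h0 : 0 < ε) (h1 : ε < 1) :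
    ε ^ 2 / 4 ≤ (1 - ε)⁻¹ - 1 - Real.log (1 - ε)⁻¹ := by
  obtain ⟨w, hw, hw2⟩ : ∃ w, 0 < w ∧ w ^ 2 = 1 - ε :=
    ⟨√(1 - ε), Real.sqrt_pos.2 (by linarith), Real.sq_sqrt (by linarith)⟩
  have hw1 : w < 1 := by nlinarith
  have hlog := Real.one_sub_inv_le_log_of_pos hw
  have hv : 1 ≤ w⁻¹ := (one_le_inv₀ hw).2 hw1.le
  have hvw : w⁻¹ * w = 1 := inv_mul_cancel₀ hw.ne'
  rw [Real.log_inv, ← hw2, Real.log_pow, show ε = 1 - w ^ 2 by linarith, ← inv_pow]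
  push_cast
  have h3 : 1 - w ≤ w⁻¹ - 1 := by nlinarith [sq_nonneg (w⁻¹ - w), sq_nonneg (1 - w)]
  have h4 : (1 - w) ^ 2 ≤ (w⁻¹ - 1) ^ 2 := pow_le_pow_left₀ (by linarith) h3 2
  nlinarith [mul_nonneg (sq_nonneg (1 - w)) (show 0 ≤ (1 - w) * (3 + w) by nlinarith)]

lemma abs_logb_le_of_mem_Icc {b c y : ℝ} (hb : 1 < b) (hc : 0 < c)
    (hy : y ∈ Set.Icc c c⁻¹) : |Real.logb b y| ≤ |Real.logb b c| := by
  have hy0 : 0 < y := hc.trans_le hy.1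
  have h1 := Real.logb_le_logb_of_le hb hc hy.1
  have h2 := Real.logb_le_logb_of_le hb hy0 hy.2
  rw [Real.logb_inv] at h2
  exact abs_le.2 ⟨by linarith [neg_abs_le (Real.logb b c), neg_le_abs (Real.logb b c)],
    by linarith [neg_le_abs (Real.logb b c)]⟩

/-- randomized trace estimator for integer-order matrix-based Rényi entropy.
With `s = ⌈8 ln(2/δ)/ε²⌉` i.i.d. standard Gaussian vectors `g₁,…,g_s`, with probability at
least `1−δ`, `|S_α(G) − S̃_α(G)| ≤ |(1/(1−α))·log₂(1−ε)|`, where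
`S_α(G) = (1/(1−α))·log₂(tr(Gᵅ))` and
`S̃_α(G) = (1/(1−α))·log₂((1/s)·Σᵢ gᵢᵀ Gᵅ gᵢ)`. -/
theorem stmt0 {n : ℕ} (G : Matrix (Fin n) (Fin n) ℝ)
    (hG : G.PosSemidef) (hG0 : G ≠ 0)
    (α : ℕ) (hα : 2 ≤ α) (ε δ : ℝ)
    (hε : ε ∈ Set.Ioo (0 : ℝ) 1) (hδ : δ ∈ Set.Ioo (0 : ℝ) 1)
    (s : ℕ) (hs : s = ⌈8 * Real.log (2 / δ) / ε ^ 2⌉₊) :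
    1 - ENNReal.ofReal δ ≤
      gaussianVecs s n
        {g | |(1 / (1 - (α : ℝ))) * Real.logb 2 ((G ^ α).trace)
              - (1 / (1 - (α : ℝ))) * Real.logb 2
                  ((1 / (s : ℝ)) * ∑ i, g i ⬝ᵥ (G ^ α).mulVec (g i))|
            ≤ |(1 / (1 - (α : ℝ))) * Real.logb 2 (1 - ε)|} := by
  obtain ⟨hε0, hε1⟩ := hε
  obtain ⟨hδ0, hδ1⟩ := hδ
  set A := G ^ α
  have hA : A.PosSemidef := hG.pow α
  have hA0 : A ≠ 0 := fun h => hG0 (hG.1.eq_zero_of_pow_eq_zero h)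
  have htr : 0 < A.trace :=
    lt_of_le_of_ne hA.trace_nonneg (Ne.symm (hA.trace_eq_zero_iff.not.2 hA0))
  have hlog : 0 < Real.log (2 / δ) := Real.log_pos (by rw [lt_div_iff₀ hδ0]; linarith)
  have hs1 : 8 * Real.log (2 / δ) / ε ^ 2 ≤ s := hs ▸ Nat.le_ceil _
  have hs0 : (0 : ℝ) < s := lt_of_lt_of_le (by positivity) hs1
  rw [div_le_iff₀ (by positivity)] at hs1
  have htail : ∀ r : ℝ, ε ^ 2 / 4 ≤ r - 1 - Real.log r →
      Real.exp (-(s / 2 * (r - 1 - Real.log r))) ≤ δ / 2 := by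
    intro r hr
    rw [← Real.le_log_iff_exp_le (by positivity), ← inv_div 2 δ, Real.log_inv]
    have := mul_le_mul_of_nonneg_left hr hs0.le
    linarith
  have hc : 0 < 1 - ε := by linarith
  have hupper := (hA.measureReal_le_sum_quadraticForm_le hA0 s
    ((one_le_inv₀ hc).2 (by linarith))).trans
    (htail _ (sq_div_four_le_inv_sub_one_sub_log hε0 hε1))
  have hlower := (hA.measureReal_sum_quadraticForm_le_le hA0 s hc (by linarith)).trans
    (htail _ (sq_div_four_le_sub_one_sub_log hε0 hε1))
  set U := {g : Fin s → Fin n → ℝ | s * (1 - ε)⁻¹ ≤ ∑ i, (g i ⬝ᵥ A *ᵥ g i) / A.trace}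
  set L := {g : Fin s → Fin n → ℝ | ∑ i, (g i ⬝ᵥ A *ᵥ g i) / A.trace ≤ s * (1 - ε)}
  have hbad : gaussianVecs s n (U ∪ L) ≤ ENNReal.ofReal δ := by
    rw [← ofReal_measureReal]
    refine ENNReal.ofReal_le_ofReal ((measureReal_union_le U L).trans ?_)
    linarith
  refine (tsub_le_tsub_left hbad 1).trans ?_
  rw [tsub_le_iff_right, ← measure_univ (μ := gaussianVecs s n)]
  refine (measure_mono fun g _ => ?_).trans (measure_union_le _ _)
  by_cases hg : g ∈ U ∪ L
  · exact Or.inr hg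
  refine Or.inl ?_
  simp only [U, L, Set.mem_union, Set.mem_ofPred_eq, not_or, not_le] at hg
  obtain ⟨hg1, hg2⟩ := hg
  rw [← Finset.sum_div] at hg1 hg2
  set Y := (∑ i, g i ⬝ᵥ A *ᵥ g i) / A.trace / s with hY
  have hY1 : 1 - ε ≤ Y := by
    rw [hY, le_div_iff₀ hs0]
    linarith
  have hY2 : Y ≤ (1 - ε)⁻¹ := by
    rw [hY, div_le_iff₀ hs0]
    linarith
  have hXY : 1 / (s : ℝ) * ∑ i, g i ⬝ᵥ A *ᵥ g i = A.trace * Y := by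
    rw [hY]
    field_simp
  have hlogY := abs_logb_le_of_mem_Icc one_lt_two hc ⟨hY1, hY2⟩
  rw [Set.mem_ofPred_eq, hXY, Real.logb_mul htr.ne' (hc.trans_le hY1).ne', ← mul_sub,
    sub_add_cancel_left, mul_neg, abs_neg, abs_mul, abs_mul]
  exact mul_le_mul_of_nonneg_left hlogY (abs_nonneg _)
end

section
/- Let α > 0 be a non-integer real, let m be an integer with m > α, let λ_max > 0, and let λ be a real number with 0 < λ ≤ λ_max. Then |λ^α − λ_max^α·Σ_{i=0}^m binom(α,i)·(λ/λ_max − 1)^i| ≤ λ_max^α·(λ_max/λ)·|binom(α,m+1)|·(1 − λ/λ_max)^{m+1}. -/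
/-- Generalized binomial coefficient `binom(α, i) = α(α−1)⋯(α−i+1)/i!` for real `α`. -/
noncomputable def rchoose (α : ℝ) (i : ℕ) : ℝ :=
  (∏ j ∈ Finset.range i, (α - j)) / (Nat.factorial i)

theorem rchoose_succ (α : ℝ) (n : ℕ) :
    rchoose α (n + 1) = rchoose α n * ((α - n) / (n + 1)) := by
  rw [rchoose, rchoose, Finset.prod_range_succ, Nat.factorial_succ]
  push_cast
  field_simp

theorem ringChoose_eq_rchoose (α : ℝ) (n : ℕ) : Ring.choose α n = rchoose α n := by
  rw [Ring.choose_eq_smul, rchoose, smul_eq_mul, div_eq_inv_mul]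
  congr 1
  induction n with
  | zero => simp
  | succ n ih =>
    rw [descPochhammer_succ_right, Polynomial.smeval_mul, ih, Finset.prod_range_succ]
    simp [Polynomial.smeval_natCast]

theorem hasSum_rchoose_mul_pow (α : ℝ) {x : ℝ} (hx : |x| < 1) :
    HasSum (fun n => rchoose α n * x ^ n) ((1 + x) ^ α) := by
  have hmem : x ∈ Metric.eball (0 : ℝ) 1 := by
    rw [← ENNReal.ofReal_one, Metric.eball_ofReal]
    simpa using hx
  simpa [binomialSeries, FormalMultilinearSeries.coeff_ofScalars, ringChoose_eq_rchoose,
      mul_comm] using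
    (Real.one_add_rpow_hasFPowerSeriesOnBall_zero (a := α)).hasSum hmem

/-- The coefficients `|binom(α, n)|` decrease once `n ≥ α`. -/
theorem abs_rchoose_add_le {α : ℝ} (hα : 0 < α) {N : ℕ} (hN : α ≤ N) (k : ℕ) :
    |rchoose α (N + k)| ≤ |rchoose α N| := by
  induction k with
  | zero => simp
  | succ k ih =>
    rw [← add_assoc, rchoose_succ, abs_mul]
    refine (mul_le_of_le_one_right (abs_nonneg _) ?_).trans ih
    have hk : (0 : ℝ) ≤ k := k.cast_nonneg
    have hN0 : (0 : ℝ) ≤ N := N.cast_nonneg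
    push_cast
    rw [abs_div, abs_of_pos (by positivity : (0 : ℝ) < N + k + 1), div_le_one (by positivity),
      abs_le]
    constructor <;> linarith

/-- Truncation error of the binomial series at the base point `1`. -/
theorem abs_rpow_sub_sum_rchoose_le {α : ℝ} (hα : 0 < α) {N : ℕ} (hN : α ≤ N) {y : ℝ}
    (hy : 0 < y) (hy1 : y ≤ 1) :
    |y ^ α - ∑ i ∈ Finset.range N, rchoose α i * (y - 1) ^ i|
      ≤ 1 / y * |rchoose α N| * (1 - y) ^ N := by
  have hsum := hasSum_rchoose_mul_pow α (x := y - 1) (by rw [abs_lt]; constructor <;> linarith)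
  rw [add_sub_cancel] at hsum
  have htail := (hasSum_nat_add_iff' N).mpr hsum
  have hgeom := (hasSum_geometric_of_lt_one (sub_nonneg.mpr hy1) (sub_lt_self 1 hy)).mul_left
    (|rchoose α N| * (1 - y) ^ N)
  refine (htail.norm_le_of_bounded hgeom fun k => ?_).trans_eq (by rw [sub_sub_cancel]; ring)
  rw [Real.norm_eq_abs, abs_mul, abs_pow, abs_sub_comm, abs_of_nonneg (sub_nonneg.mpr hy1),
    add_comm k N, pow_add, ← mul_assoc]
  have h1y := sub_nonneg.mpr hy1
  gcongr ?_ * _ * _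
  exact abs_rchoose_add_le hα hN k

/-- truncation error of the binomial (Taylor) series of `λ^α` around `λ_max`,
for `0 < λ ≤ λ_max`, non-integer `α > 0` and integer `m > α`. -/
theorem stmt5 (α : ℝ) (hα : 0 < α) (hαni : ∀ k : ℕ, α ≠ k) (m : ℕ) (hm : α < m)
    (lmax lam : ℝ) (hlmax : 0 < lmax) (hlam : 0 < lam) (hle : lam ≤ lmax) :
    |lam ^ α - lmax ^ α * ∑ i ∈ Finset.range (m + 1), rchoose α i * (lam / lmax - 1) ^ i|
      ≤ lmax ^ α * (lmax / lam) * |rchoose α (m + 1)| * (1 - lam / lmax) ^ (m + 1) := by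
  have hy : 0 < lam / lmax := div_pos hlam hlmax
  have hN : α ≤ (m + 1 : ℕ) := by push_cast; linarith
  have key := abs_rpow_sub_sum_rchoose_le hα hN hy ((div_le_one hlmax).mpr hle)
  have hpow : lam ^ α = lmax ^ α * (lam / lmax) ^ α := by
    rw [← Real.mul_rpow hlmax.le hy.le, mul_div_cancel₀ lam hlmax.ne']
  rw [hpow, ← mul_sub, abs_mul, abs_of_pos (Real.rpow_pos_of_pos hlmax α), mul_assoc, mul_assoc,
    ← mul_assoc (lmax / lam)]
  rw [one_div_div] at key
  gcongr
end

section
/- For every non-integer real α > 0 and every integer m > α, |binom(α, m+1)| ≤ Γ(α+1)/(π·(m−α+1)^{α+1}). -/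
/-- A falling factorial at a non-natural real is a quotient of Gamma values. -/
theorem prod_range_sub_mul_Gamma (α : ℝ) (h : ∀ k : ℕ, α ≠ k) (n : ℕ) :
    (∏ j ∈ Finset.range n, (α - j)) * Real.Gamma (α - n + 1) = Real.Gamma (α + 1) := by
  induction n with
  | zero => simp
  | succ n ih =>
    rw [← ih, Finset.prod_range_succ, Real.Gamma_add_one (sub_ne_zero.mpr (h n)), mul_assoc]
    rw [show α - ((n + 1 : ℕ) : ℝ) + 1 = α - n by push_cast; ring]

/-- Log-convexity of Gamma bounds its growth over a step of length at least one. -/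
theorem rpow_mul_Gamma_le_Gamma_add {x s : ℝ} (hx : 0 < x) (hs : 1 < s) :
    x ^ s * Real.Gamma x ≤ Real.Gamma (x + s) := by
  have hΓ := Real.Gamma_pos_of_pos hx
  have hΓs := Real.Gamma_pos_of_pos (show 0 < x + s by linarith)
  have key := Real.convexOn_log_Gamma.secant_mono (a := x) (x := x + 1) (y := x + s)
    hx (show 0 < x + 1 by linarith) (show 0 < x + s by linarith)
    (by linarith) (by linarith) (by linarith)
  simp only [Function.comp, add_sub_cancel_left, div_one] at key
  rw [Real.Gamma_add_one hx.ne', Real.log_mul hx.ne' hΓ.ne', le_div_iff₀ (by linarith)] at key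
  rw [← Real.log_le_log_iff (by positivity) hΓs, Real.log_mul (by positivity) hΓ.ne',
    Real.log_rpow hx]
  linarith

/-- for every non-integer real `α > 0` and every integer `m > α`,
`|binom(α, m+1)| ≤ Γ(α+1)/(π·(m−α+1)^{α+1})`. -/
theorem stmt6 (α : ℝ) (hα : 0 < α) (hαni : ∀ k : ℕ, α ≠ k) (m : ℕ) (hm : α < m) :
    |rchoose α (m + 1)| ≤ Real.Gamma (α + 1) / (Real.pi * ((m : ℝ) - α + 1) ^ (α + 1)) := by
  have hx : 0 < (m : ℝ) - α + 1 := by linarith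
  have hprod := prod_range_sub_mul_Gamma α hαni (m + 1)
  have hrefl := Real.Gamma_mul_Gamma_one_sub ((m : ℝ) - α + 1)
  have hgrow := rpow_mul_Gamma_le_Gamma_add hx (show 1 < α + 1 by linarith)
  rw [show (m : ℝ) - α + 1 + (α + 1) = ((m + 1 : ℕ) : ℝ) + 1 by push_cast; ring,
    Real.Gamma_nat_eq_factorial] at hgrow
  rw [show α - ((m + 1 : ℕ) : ℝ) + 1 = 1 - ((m : ℝ) - α + 1) by push_cast; ring] at hprod
  unfold rchoose
  set P := ∏ j ∈ Finset.range (m + 1), (α - j)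
  set x := (m : ℝ) - α + 1
  have hΓα := Real.Gamma_pos_of_pos (show 0 < α + 1 by linarith)
  have hΓx := Real.Gamma_pos_of_pos hx
  have hπ := Real.pi_pos
  have hfac : (0 : ℝ) < (m + 1).factorial := by exact_mod_cast Nat.factorial_pos _
  have hP : P * Real.pi / Real.sin (Real.pi * x) = Real.Gamma (α + 1) * Real.Gamma x := by
    rw [mul_div_assoc, ← hrefl, ← hprod]
    ring
  have hsin : Real.sin (Real.pi * x) ≠ 0 := by
    intro h
    rw [h, div_zero] at hP
    exact (mul_pos hΓα hΓx).ne hP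
  rw [div_eq_iff hsin] at hP
  have habs : |P| * Real.pi ≤ Real.Gamma (α + 1) * Real.Gamma x := by
    rw [← abs_of_pos hπ, ← abs_mul, hP, abs_mul, abs_of_pos (mul_pos hΓα hΓx)]
    exact mul_le_of_le_one_right (by positivity) (Real.abs_sin_le_one _)
  rw [abs_div, abs_of_pos hfac, div_le_div_iff₀ hfac (by positivity)]
  calc |P| * (Real.pi * x ^ (α + 1)) = |P| * Real.pi * x ^ (α + 1) := by ring
    _ ≤ Real.Gamma (α + 1) * Real.Gamma x * x ^ (α + 1) := by gcongr
    _ = Real.Gamma (α + 1) * (x ^ (α + 1) * Real.Gamma x) := by ring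
    _ ≤ Real.Gamma (α + 1) * (m + 1).factorial := by gcongr
end

section
/- For every real α > 0 and every natural number m, the series Σ_{i=m+1}^∞ binom(α+1, i)·(−1)^i converges absolutely and binom(α, m)·(−1)^m + Σ_{i=m+1}^∞ binom(α+1, i)·(−1)^i = 0. -/
open Filter Topology Finset

theorem rchoose_succ_mul_neg_one_pow (α : ℝ) (n : ℕ) :
    rchoose α (n + 1) * (-1 : ℝ) ^ (n + 1) =
      rchoose α n * (-1 : ℝ) ^ n * ((n - α) / (n + 1)) := by
  have h1 : (n : ℝ) + 1 ≠ 0 := by positivity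
  have h2 : (n.factorial : ℝ) ≠ 0 := by positivity
  simp only [rchoose, prod_range_succ, Nat.factorial_succ, Nat.cast_mul, Nat.cast_succ, pow_succ]
  field_simp
  ring

theorem rchoose_add_one_succ (α : ℝ) (n : ℕ) :
    rchoose (α + 1) (n + 1) = rchoose α n * ((α + 1) / (n + 1)) := by
  have h1 : (n : ℝ) + 1 ≠ 0 := by positivity
  have h2 : (n.factorial : ℝ) ≠ 0 := by positivity
  have h3 : ∀ j ∈ range n, α + 1 - ((j + 1 : ℕ) : ℝ) = α - j := by
    intro j _
    push_cast
    ring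
  simp only [rchoose, prod_range_succ' _ n, Nat.factorial_succ, Nat.cast_mul, Nat.cast_succ]
  simp only [← Nat.cast_succ, prod_congr rfl h3]
  push_cast
  field_simp
  ring

/-- Pascal's rule for the alternating generalized binomial coefficients. -/
theorem rchoose_add_one_succ_mul_neg_one_pow (α : ℝ) (n : ℕ) :
    rchoose (α + 1) (n + 1) * (-1 : ℝ) ^ (n + 1) =
      rchoose α (n + 1) * (-1 : ℝ) ^ (n + 1) - rchoose α n * (-1 : ℝ) ^ n := by
  have h1 : (n : ℝ) + 1 ≠ 0 := by positivity
  rw [rchoose_succ_mul_neg_one_pow α, rchoose_add_one_succ, pow_succ]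
  field_simp
  ring

theorem abs_rchoose_add_one_succ {α : ℝ} (hα : 0 < α + 1) (n : ℕ) :
    |rchoose (α + 1) (n + 1) * (-1 : ℝ) ^ (n + 1)| = |rchoose α n| * ((α + 1) / (n + 1)) := by
  have h : 0 < (α + 1) / ((n : ℝ) + 1) := by positivity
  rw [rchoose_add_one_succ, abs_mul, abs_mul, abs_pow, abs_of_pos h]
  simp

theorem abs_rchoose_succ {α : ℝ} {n : ℕ} (hn : α ≤ n) :
    |rchoose α (n + 1)| = |rchoose α n| * ((n - α) / (n + 1)) := by
  have h : 0 ≤ ((n : ℝ) - α) / (n + 1) := div_nonneg (sub_nonneg.2 hn) (by positivity)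
  have := congrArg abs (rchoose_succ_mul_neg_one_pow α n)
  simpa [abs_mul, abs_of_nonneg h] using this

theorem summable_abs_rchoose_add_one {α : ℝ} (hα : 0 < α + 1) :
    Summable fun n : ℕ => |rchoose (α + 1) (n + 1) * (-1 : ℝ) ^ (n + 1)| := by
  obtain ⟨K, hK⟩ := exists_nat_ge α
  rw [← summable_nat_add_iff K]
  refine summable_of_sum_range_le (c := |rchoose α K|) (fun _ => abs_nonneg _) fun N => ?_
  have key : ∀ n, |rchoose (α + 1) (n + K + 1) * (-1 : ℝ) ^ (n + K + 1)| =
      |rchoose α (n + K)| - |rchoose α (n + 1 + K)| := by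
    intro n
    have hn : α ≤ (n + K : ℕ) := hK.trans (by exact_mod_cast Nat.le_add_left K n)
    have h1 : ((n + K : ℕ) : ℝ) + 1 ≠ 0 := by positivity
    rw [abs_rchoose_add_one_succ hα, Nat.add_right_comm, abs_rchoose_succ hn]
    field_simp
    ring
  rw [sum_congr rfl fun n _ => key n, sum_range_sub' (fun n => |rchoose α (n + K)|)]
  simp

theorem tendsto_rchoose_mul_neg_one_pow {α : ℝ} (hα : 0 < α + 1) :
    Tendsto (fun n : ℕ => rchoose α n * (-1 : ℝ) ^ n) atTop (𝓝 0) := by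
  have hs := summable_abs_rchoose_add_one hα
  have ht := hs.of_abs.hasSum.tendsto_sum_nat
  simp only [rchoose_add_one_succ_mul_neg_one_pow,
    sum_range_sub (fun n => rchoose α n * (-1 : ℝ) ^ n)] at ht
  obtain ⟨l, hl⟩ : ∃ l, Tendsto (fun n : ℕ => rchoose α n * (-1 : ℝ) ^ n) atTop (𝓝 l) :=
    ⟨_, (ht.add_const (rchoose α 0 * (-1 : ℝ) ^ 0)).congr fun _ => sub_add_cancel _ _⟩
  obtain rfl | hl0 := eq_or_ne l 0
  · exact hl
  have hc : 0 < |l| / 2 := by positivity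
  have hev : ∀ᶠ n : ℕ in atTop, |l| / 2 < |rchoose α n| := by
    have := hl.abs.eventually_const_lt (half_lt_self (abs_pos.2 hl0))
    simpa [abs_mul] using this
  refine absurd ((summable_nat_add_iff 1).1 (Summable.of_norm_bounded_eventually_nat
    (hs.mul_left (|l| / 2 * (α + 1))⁻¹) ?_)) Real.not_summable_one_div_natCast
  filter_upwards [hev] with n hn
  have h1 : (0 : ℝ) < (n : ℝ) + 1 := by positivity
  rw [abs_rchoose_add_one_succ hα, Real.norm_of_nonneg (by positivity), Nat.cast_succ,
    ← div_eq_inv_mul, le_div_iff₀ (by positivity)]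
  calc 1 / ((n : ℝ) + 1) * (|l| / 2 * (α + 1)) = |l| / 2 * ((α + 1) / (n + 1)) := by ring
    _ ≤ _ := by gcongr

/-- for every real `α > 0` and natural `m`, the tail series
`Σ_{i=m+1}^∞ binom(α+1, i)·(−1)^i` converges absolutely and
`binom(α, m)·(−1)^m + Σ_{i=m+1}^∞ binom(α+1, i)·(−1)^i = 0`. -/
theorem stmt7 (α : ℝ) (hα : 0 < α) (m : ℕ) :
    Summable (fun i : ℕ => |rchoose (α + 1) (m + 1 + i) * (-1 : ℝ) ^ (m + 1 + i)|) ∧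
    rchoose α m * (-1 : ℝ) ^ m
      + ∑' i : ℕ, rchoose (α + 1) (m + 1 + i) * (-1 : ℝ) ^ (m + 1 + i) = 0 := by
  have hα' : 0 < α + 1 := by linarith
  have hs : Summable fun i : ℕ => |rchoose (α + 1) (m + 1 + i) * (-1 : ℝ) ^ (m + 1 + i)| := by
    have := (summable_nat_add_iff m).2 (summable_abs_rchoose_add_one hα')
    simpa only [show ∀ i, i + m + 1 = m + 1 + i from fun i => by ring] using this
  refine ⟨hs, ?_⟩
  have hterm : ∀ i, rchoose (α + 1) (m + 1 + i) * (-1 : ℝ) ^ (m + 1 + i) =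
      rchoose α (i + 1 + m) * (-1 : ℝ) ^ (i + 1 + m) - rchoose α (i + m) * (-1 : ℝ) ^ (i + m) := by
    intro i
    rw [show m + 1 + i = i + m + 1 by ring, show i + 1 + m = i + m + 1 by ring,
      rchoose_add_one_succ_mul_neg_one_pow]
  have ht := hs.of_abs.hasSum.tendsto_sum_nat
  simp only [hterm, sum_range_sub (fun i => rchoose α (i + m) * (-1 : ℝ) ^ (i + m))] at ht
  have hlim := ((tendsto_add_atTop_iff_nat m).2 (tendsto_rchoose_mul_neg_one_pow hα')).sub_const
    (rchoose α (0 + m) * (-1 : ℝ) ^ (0 + m))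
  simp only [hterm, tendsto_nhds_unique ht hlim]
  simp
end

section
/- Let x > 0 be real. Then: (i) for every real y with 1 ≤ y ≤ 2, Γ(x+y) ≥ Γ(x)·x^y; and (ii) for every real y ≥ 2, Γ(x+y) ≥ Γ(x)·x·(x+1)^{y−1}. -/
/-- A consequence of log-convexity: `Γ` grows at least geometrically with ratio `x` beyond `x + 1`. -/
theorem Real.Gamma_mul_rpow_le_Gamma_add {x y : ℝ} (hx : 0 < x) (hy : 1 ≤ y) :
    Real.Gamma x * x ^ y ≤ Real.Gamma (x + y) := by
  rcases hy.eq_or_lt with rfl | hy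
  · rw [Real.rpow_one, Real.Gamma_add_one hx.ne', mul_comm]
  have hxy : 0 < x + y := by linarith
  have hΓ : 0 < Real.Gamma x := Real.Gamma_pos_of_pos hx
  have h := Real.convexOn_log_Gamma.slope_mono_adjacent (x := x) (y := x + 1) (z := x + y)
    hx hxy (by linarith) (by linarith)
  simp only [Function.comp_apply, Real.Gamma_add_one hx.ne', Real.log_mul hx.ne' hΓ.ne',
    add_sub_cancel_left, add_sub_cancel_right, div_one, add_sub_add_left_eq_sub] at h
  rw [le_div_iff₀ (sub_pos.2 hy)] at h
  rw [← Real.log_le_log_iff (by positivity) (Real.Gamma_pos_of_pos hxy),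
    Real.log_mul hΓ.ne' (by positivity), Real.log_rpow hx]
  linarith

/-- for real `x > 0`:
(i) for `1 ≤ y ≤ 2`, `Γ(x+y) ≥ Γ(x)·x^y`;
(ii) for `y ≥ 2`, `Γ(x+y) ≥ Γ(x)·x·(x+1)^{y−1}`. -/
theorem stmt9 (x : ℝ) (hx : 0 < x) :
    (∀ y : ℝ, 1 ≤ y → y ≤ 2 → Real.Gamma x * x ^ y ≤ Real.Gamma (x + y)) ∧
    (∀ y : ℝ, 2 ≤ y → Real.Gamma x * (x * (x + 1) ^ (y - 1)) ≤ Real.Gamma (x + y)) := by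
  refine ⟨fun y hy _ => Real.Gamma_mul_rpow_le_Gamma_add hx hy, fun y hy => ?_⟩
  have h := Real.Gamma_mul_rpow_le_Gamma_add (x := x + 1) (y := y - 1) (by linarith) (by linarith)
  rwa [Real.Gamma_add_one hx.ne', add_add_sub_cancel, mul_comm x, mul_assoc] at h
end
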